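/- Adams's Thesis for bivalent antecedent and consequent: let v_A, v_C : W → {0,1} be bivalent truth assignments (taking only values 0 and 1) with c{v_A=1} > 0. Define the conditional assignment (v_A → v_C)(w) := f→(v_A(w), v_C(w)) via the Cooper table. Then p(v_A → v_C) = c({v_A=1} ∩ {v_C=1}) / c({v_A=1}), i.e., the trivalent probability of the conditional equals the conditional probability of C given A. -/

import Mathlib

/-- The set of trivalent truth values {0, 1/2, 1} inside ℚ. -/
def Tri (x : ℚ) : Prop := x = 0 ∨ x = 1/2 ∨ x = 1

/-- Cooper conditional: f→(0,y)=1/2, f→(1,y)=y, f→(1/2,y)=y (on trivalent values). -/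
def tcond (a b : ℚ) : ℚ := if a = 0 then 1/2 else b

/-- Quasi-conjunction. -/
def tand (a b : ℚ) : ℚ :=
  if a = 0 ∨ b = 0 then 0 else if a = 1 ∨ b = 1 then 1 else 1/2

/-- Quasi-disjunction. -/
def tor (a b : ℚ) : ℚ :=
  if a = 1 ∨ b = 1 then 1 else if a = 0 ∨ b = 0 then 0 else 1/2

/-- Strong Kleene negation. -/
def tneg (a : ℚ) : ℚ := 1 - a

open Finset in
/-- Weight of the worlds where the assignment `v` takes the value `x`. -/
def wt {W : Type*} [Fintype W] (c : W → ℝ) (v : W → ℚ) (x : ℚ) : ℝ :=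
  ∑ w ∈ Finset.univ.filter (fun w => v w = x), c w

/-- Trivalent probability of a truth assignment. -/
noncomputable def pv {W : Type*} [Fintype W] (c : W → ℝ) (v : W → ℚ) : ℝ :=
  if 0 < wt c v 1 + wt c v 0 then wt c v 1 / (wt c v 1 + wt c v 0) else 1

/-- A conditional with bivalent antecedent is true exactly where antecedent and consequent are. -/
lemma wt_tcond_one {W : Type*} [Fintype W] (c : W → ℝ) (vA vC : W → ℚ)
    (hA : ∀ w, vA w = 0 ∨ vA w = 1) :
    wt c (fun w => tcond (vA w) (vC w)) 1 =
      ∑ w ∈ Finset.univ.filter (fun w => vA w = 1 ∧ vC w = 1), c w := by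
  unfold wt
  congr 1
  ext w
  rcases hA w with h | h <;> norm_num [tcond, h]

/-- A conditional with bivalent antecedent and consequent is defined exactly where the
antecedent is true. -/
lemma wt_tcond_one_add_wt_tcond_zero {W : Type*} [Fintype W] (c : W → ℝ) (vA vC : W → ℚ)
    (hA : ∀ w, vA w = 0 ∨ vA w = 1) (hC : ∀ w, vC w = 0 ∨ vC w = 1) :
    wt c (fun w => tcond (vA w) (vC w)) 1 + wt c (fun w => tcond (vA w) (vC w)) 0 =
      wt c vA 1 := by
  simp only [wt, Finset.sum_filter, ← Finset.sum_add_distrib]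
  refine Finset.sum_congr rfl fun w _ => ?_
  rcases hA w with h | h <;> rcases hC w with h' | h' <;> norm_num [tcond, h, h']

open Finset in
/-- Adams's Thesis: for bivalent A and C, p(A → C) equals the conditional probability. -/
theorem adams_thesis {W : Type*} [Fintype W] (c : W → ℝ)
    (hc : ∀ w, 0 ≤ c w) (hsum : ∑ w, c w = 1)
    (vA vC : W → ℚ) (hA : ∀ w, vA w = 0 ∨ vA w = 1) (hC : ∀ w, vC w = 0 ∨ vC w = 1)
    (hpos : 0 < wt c vA 1) :
    pv c (fun w => tcond (vA w) (vC w)) =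
      (∑ w ∈ Finset.univ.filter (fun w => vA w = 1 ∧ vC w = 1), c w) / wt c vA 1 := by
  rw [pv, wt_tcond_one_add_wt_tcond_zero c vA vC hA hC, if_pos hpos, wt_tcond_one c vA vC hA]
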